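/- The counterexample to Reichenbach's universal force. Define Ω : ℝ⁴ → ℝ by Ω(p) = (p 1)² + 1/2 and γ : ℝ → ℝ⁴ by γ(s) = (s, 1/√2, 0, 0). Let Γᵃ_{bc}(p) = Ω(p)⁻¹ (δᵃ_b ∂_c Ω(p) + δᵃ_c ∂_b Ω(p) − η_{bc} Σ_d ηᵃᵈ ∂_d Ω(p)) be the Levi-Civita connection coefficients of the conformally flat metric g̃ = Ω² η in standard coordinates, where η_{bc} and ηᵃᵈ are the components diag(1,−1,−1,−1). Then: (i) Ω(γ(s)) = 1 for all s, so the Reichenbach universal force field G = η − Ω²η (componentwise, (1 − Ω(γ(s))²)·η) vanishes at every point of γ; (ii) γ''(s) = 0 for all s, so γ is an affinely parametrized geodesic of the flat metric η; and (iii) the acceleration of γ relative to the Levi-Civita derivative operator of g̃, namely aᵃ(s) = γ''ᵃ(s) + Γᵃ_{bc}(γ(s)) γ'ᵇ(s) γ'ᶜ(s), equals √2 in the a = 1 (x-direction) component and 0 in the other components for all s; in particular it is nonvanishing along γ even though G vanishes along γ. Hence the field G cannot be a force field in the standard sense, since it vanishes where the acceleration it is meant to produce is nonzero. -/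

import Mathlib

noncomputable section

/-- The Minkowski bilinear form on ℝ⁴. -/
def eta (u v : Fin 4 → ℝ) : ℝ :=
  u 0 * v 0 - u 1 * v 1 - u 2 * v 2 - u 3 * v 3

/-- The components `diag(1,-1,-1,-1)` of the Minkowski metric (and of its inverse). -/
def etaM (a b : Fin 4) : ℝ :=
  if a = b then (if a = 0 then 1 else -1) else 0

/-- The conformal factor `Ω(p) = x² + 1/2`. -/
def Om (p : Fin 4 → ℝ) : ℝ := (p 1) ^ 2 + 1 / 2

/-- Partial derivative of `f : ℝ⁴ → ℝ` in the `c`-th coordinate direction at `p`. -/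
def pd (f : (Fin 4 → ℝ) → ℝ) (c : Fin 4) (p : Fin 4 → ℝ) : ℝ :=
  fderiv ℝ f p (Pi.single c 1)

/-- The Levi-Civita connection coefficients of the conformally flat metric
`g̃ = Ω² η` in standard coordinates:
`Γᵃ_{bc}(p) = Ω(p)⁻¹ (δᵃ_b ∂_c Ω + δᵃ_c ∂_b Ω − η_{bc} Σ_d ηᵃᵈ ∂_d Ω)`. -/
def Γconf (a b c : Fin 4) (p : Fin 4 → ℝ) : ℝ :=
  (Om p)⁻¹ * ((if a = b then pd Om c p else 0) + (if a = c then pd Om b p else 0)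
    - etaM b c * ∑ d : Fin 4, etaM a d * pd Om d p)

/-- The curve `γ(s) = (s, 1/√2, 0, 0)`. -/
def γcurve (s : ℝ) : Fin 4 → ℝ := ![s, 1 / Real.sqrt 2, 0, 0]

theorem aux_Om (s : ℝ) : Om (γcurve s) = 1 := by
  have h : Real.sqrt 2 ^ 2 = 2 := Real.sq_sqrt (by norm_num)
  simp only [Om, γcurve, Matrix.cons_val_one, Matrix.cons_val_zero, div_pow, h]
  norm_num

theorem aux_deriv : deriv γcurve = fun _ => ![1, 0, 0, 0] := by
  funext s
  apply HasDerivAt.deriv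
  rw [hasDerivAt_pi]
  intro i
  fin_cases i
  · exact hasDerivAt_id s
  · exact hasDerivAt_const s _
  · exact hasDerivAt_const s _
  · exact hasDerivAt_const s _

theorem aux_pd (c : Fin 4) (p : Fin 4 → ℝ) : pd Om c p = if c = 1 then 2 * p 1 else 0 := by
  have h1 : HasFDerivAt (fun p : Fin 4 → ℝ => p 1)
      (ContinuousLinearMap.proj (R := ℝ) (φ := fun _ : Fin 4 => ℝ) 1) p :=
    hasFDerivAt_apply 1 p
  have h2 := (h1.pow 2).add_const (1 / 2 : ℝ)
  have h3 : fderiv ℝ Om p = _ := h2.fderiv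
  rw [pd, h3]
  fin_cases c <;> simp

/-- The counterexample to Reichenbach's universal force: along the curve
`γ(s) = (s, 1/√2, 0, 0)`, (i) the conformal factor `Ω` equals `1`, so the
Reichenbach force field `G = η − Ω²η` vanishes at every point of the curve;
(ii) `γ'' = 0`, so `γ` is an affinely parametrized geodesic of the flat metric
`η`; yet (iii) the acceleration of `γ` relative to the Levi-Civita derivative
operator of `g̃ = Ω²η` is `√2` in the `x`-component and `0` in the others,
hence nonvanishing even though `G` vanishes along `γ`. -/
theorem reichenbach_counterexample :
    (∀ s : ℝ, Om (γcurve s) = 1) ∧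
    (∀ s : ℝ, ∀ a b : Fin 4, (1 - (Om (γcurve s)) ^ 2) * etaM a b = 0) ∧
    (∀ s : ℝ, deriv (deriv γcurve) s = 0) ∧
    (∀ s : ℝ, ∀ a : Fin 4,
      deriv (deriv γcurve) s a +
        ∑ b : Fin 4, ∑ c : Fin 4,
          Γconf a b c (γcurve s) * deriv γcurve s b * deriv γcurve s c =
      if a = 1 then Real.sqrt 2 else 0) := by
  have h2 : ∀ s : ℝ, deriv (deriv γcurve) s = 0 := by
    intro s
    rw [aux_deriv]
    exact deriv_const s _
  refine ⟨aux_Om, fun s a b => by rw [aux_Om]; ring, h2, fun s a => ?_⟩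
  have h : Real.sqrt 2 * Real.sqrt 2 = 2 := Real.mul_self_sqrt (by norm_num)
  have h0 : Real.sqrt 2 ≠ 0 := by positivity
  have h' : 2 * (1 / Real.sqrt 2) = Real.sqrt 2 := by
    field_simp
    nlinarith
  have hg : γcurve s 1 = 1 / Real.sqrt 2 := rfl
  rw [h2, aux_deriv]
  simp only [Γconf, aux_Om, aux_pd, hg, h', Fin.sum_univ_four, etaM]
  fin_cases a <;> simp

end
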